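/- Let d ≥ 3 and L₀ ≥ 8, let w be a doubly infinite transient trajectory in ℤ^d, and let n₀ < … < n_J be cut-times of w with n_{j+1} − n_j ≥ 2 for j = 0,…,J−1. If diam(𝒰_j) < L₀/4 for all j = 0,…,J−1, then χ(fill({w(l) : n₀ < l < n_J})) = 0. -/

import Mathlib

/-- Points of `ℤ^d`. -/
abbrev Pt (d : ℕ) := Fin d → ℤ

namespace RI

variable {d : ℕ}

/-- `l¹` distance between two points (ℕ-valued). -/
def n1 (x y : Pt d) : ℕ := ∑ j, (x j - y j).natAbs

/-- `l∞` distance between two points (ℕ-valued). -/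
def ninf (x y : Pt d) : ℕ := Finset.univ.sup fun j => (x j - y j).natAbs

/-- nearest-neighbor adjacency: `‖x - y‖₁ = 1` -/
def adj (x y : Pt d) : Prop := n1 x y = 1

/-- `*`-adjacency: `‖x - y‖_∞ = 1` -/
def adjStar (x y : Pt d) : Prop := ninf x y = 1

/-- `τ` is a nearest-neighbor path of length `N`. -/
def IsPath (τ : ℕ → Pt d) (N : ℕ) : Prop := ∀ l < N, adj (τ l) (τ (l + 1))

/-- the range of a path of length `N` -/
def pathRange (τ : ℕ → Pt d) (N : ℕ) : Set (Pt d) := τ '' {l | l ≤ N}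

/-- `x` and `y` are joined by a nearest-neighbor path all of whose points lie in `U`. -/
def ConnIn (U : Set (Pt d)) (x y : Pt d) : Prop :=
  ∃ τ N, IsPath τ N ∧ τ 0 = x ∧ τ N = y ∧ ∀ l ≤ N, τ l ∈ U

/-- a set is connected: any two of its points are joined by a path inside it -/
def ConnSet (A : Set (Pt d)) : Prop := ∀ x ∈ A, ∀ y ∈ A, ConnIn A x y

/-- the connected component of `U` containing `x` -/
def comp (U : Set (Pt d)) (x : Pt d) : Set (Pt d) := {y | ConnIn U x y}

/-- the (outer) boundary `∂K` -/
def bd (K : Set (Pt d)) : Set (Pt d) := {x | x ∉ K ∧ ∃ y ∈ K, adj x y}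

/-- the `*`-boundary `∂*K` -/
def bdStar (K : Set (Pt d)) : Set (Pt d) := {x | x ∉ K ∧ ∃ y ∈ K, adjStar x y}

/-- the interior boundary `∂_int K` -/
def intBd (K : Set (Pt d)) : Set (Pt d) := {x | x ∈ K ∧ ∃ y, y ∉ K ∧ adj x y}

/-- the `l∞` diameter of a set, valued in `ℕ∞` -/
noncomputable def diam (K : Set (Pt d)) : ℕ∞ := ⨆ x ∈ K, ⨆ y ∈ K, (ninf x y : ℕ∞)

/-- the `l¹` distance between `K` and `K'` exceeds `1` -/
def far1 (K K' : Set (Pt d)) : Prop := ∀ x ∈ K, ∀ y ∈ K', 1 < n1 x y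

/-- the `l∞` distance between `K` and `K'` exceeds `1` -/
def farInf (K K' : Set (Pt d)) : Prop := ∀ x ∈ K, ∀ y ∈ K', 1 < ninf x y

/-- `d_∞(K, K') ≤ r` -/
def dInfLE (K K' : Set (Pt d)) (r : ℕ) : Prop := ∃ x ∈ K, ∃ y ∈ K', ninf x y ≤ r

/-- `fill A`: the set of points every connected set around which inside `Aᶜ` is finite;
for `d ≥ 2` and finite `A` this is exactly the complement of the unique infinite
connected component of `Aᶜ`. -/
def fill (A : Set (Pt d)) : Set (Pt d) :=
  {z | ∀ S : Set (Pt d), z ∈ S → S ⊆ Aᶜ → ConnSet S → S.Finite}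

/-- `A₁` and `A₂` are separated by `𝒰` in `B`: `d(A₁,A₂) > 1` and every path in `B`
joining `∂A₁` to `∂A₂` meets `𝒰`. -/
def SeparatedBy (A₁ A₂ 𝒰 B : Set (Pt d)) : Prop :=
  far1 A₁ A₂ ∧
  ∀ τ N, IsPath τ N → (∀ l ≤ N, τ l ∈ B) → τ 0 ∈ bd A₁ → τ N ∈ bd A₂ →
    ∃ l ≤ N, τ l ∈ 𝒰

/-- the scales `L_κ = L₀ (80 L)^κ` -/
def Lscale (L L₀ κ : ℕ) : ℕ := L₀ * (80 * L) ^ κ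

/-- the box `C_{(κ,i)} = (i L_κ + [0, L_κ)^d) ∩ ℤ^d` -/
def boxC (L L₀ κ : ℕ) (i : Pt d) : Set (Pt d) :=
  {x | ∀ j, i j * (Lscale L L₀ κ : ℤ) ≤ x j ∧
    x j < i j * (Lscale L L₀ κ : ℤ) + (Lscale L L₀ κ : ℤ)}

/-- the neighborhood `C_{(κ,i)}^l = ⋃_{‖j‖_∞ < l} C_{(κ, i+j)}` -/
def boxCl (L L₀ κ : ℕ) (i : Pt d) (l : ℕ) : Set (Pt d) :=
  ⋃ j ∈ {j : Pt d | ∀ t, (j t).natAbs < l}, boxC L L₀ κ (i + j)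

/-- the separation event `χ_{(κ,i)}(𝒰) = 1`: there are connected sets
`A₁, A₂ ⊆ C_{(κ,i)}^2` of diameter at least `L_κ / 2` separated by `𝒰` in `C_{(κ,i)}^3` -/
def chi (L L₀ κ : ℕ) (i : Pt d) (𝒰 : Set (Pt d)) : Prop :=
  ∃ A₁ A₂ : Set (Pt d), A₁ ⊆ boxCl L L₀ κ i 2 ∧ A₂ ⊆ boxCl L L₀ κ i 2 ∧
    ConnSet A₁ ∧ ConnSet A₂ ∧
    (Lscale L L₀ κ : ℕ∞) ≤ 2 * diam A₁ ∧ (Lscale L L₀ κ : ℕ∞) ≤ 2 * diam A₂ ∧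
    SeparatedBy A₁ A₂ 𝒰 (boxCl L L₀ κ i 3)

/-- the centered boxes `C^l = [-(l-1)L₀, l L₀)^d ∩ ℤ^d` -/
def boxCen (L₀ l : ℕ) : Set (Pt d) :=
  {x | ∀ j, -(((l : ℤ) - 1) * (L₀ : ℤ)) ≤ x j ∧ x j < (l : ℤ) * (L₀ : ℤ)}

/-- the separation event `χ(𝒰) = 1` for the centered boxes -/
def chi0 (L₀ : ℕ) (𝒰 : Set (Pt d)) : Prop :=
  ∃ A₁ A₂ : Set (Pt d), A₁ ⊆ boxCen L₀ 2 ∧ A₂ ⊆ boxCen L₀ 2 ∧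
    ConnSet A₁ ∧ ConnSet A₂ ∧
    (L₀ : ℕ∞) ≤ 2 * diam A₁ ∧ (L₀ : ℕ∞) ≤ 2 * diam A₂ ∧
    SeparatedBy A₁ A₂ 𝒰 (boxCen L₀ 3)

/-- `A` is `h`-avoidable in `C`: every path in `C` with endpoints outside `A` can be
modified, within `l∞` distance `h` of its range and through `Range(τ) ∪ ∂*A`,
into a path with the same endpoints avoiding `A`. -/
def Avoidable (h : ℝ) (A C : Set (Pt d)) : Prop :=
  ∀ τ N, IsPath τ N → (∀ l ≤ N, τ l ∈ C) → τ 0 ∉ A → τ N ∉ A →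
    ∃ τ' N', IsPath τ' N' ∧ τ' 0 = τ 0 ∧ τ' N' = τ N ∧
      (∀ l ≤ N', τ' l ∉ A) ∧
      (∀ l ≤ N', (∃ k ≤ N, (ninf (τ' l) (τ k) : ℝ) ≤ h) ∧
        (τ' l ∈ pathRange τ N ∨ τ' l ∈ bdStar A))

/-- a doubly infinite transient nearest-neighbor trajectory -/
def IsTraj (w : ℤ → Pt d) : Prop :=
  (∀ l : ℤ, adj (w l) (w (l + 1))) ∧
  Filter.Tendsto (fun l : ℤ => n1 (w l) 0) Filter.cofinite Filter.atTop

/-- `k` is a cut-time of `w`: `d_∞({w(l) : l < k}, {w(l) : l > k}) > 1` -/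
def CutTime (w : ℤ → Pt d) (k : ℤ) : Prop :=
  ∀ l, l < k → ∀ l', k < l' → 1 < ninf (w l) (w l')

/-- the `j`-th sausage `𝒰_j = {w(l) : n_j < l < n_{j+1}}` -/
def sausage (w : ℤ → Pt d) (n : ℕ → ℤ) (j : ℕ) : Set (Pt d) :=
  w '' {l | n j < l ∧ l < n (j + 1)}

/-- boxes: products of integer intervals -/
def IsBox (B : Set (Pt d)) : Prop :=
  ∃ a b : Pt d, B = {x | ∀ j, a j ≤ x j ∧ x j ≤ b j}

/-- the smallest box containing `K` -/
def sbox (K : Set (Pt d)) : Set (Pt d) := ⋂₀ {B | IsBox B ∧ K ⊆ B}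

/-- the closed `l∞` ball `B(x, r)` -/
def ball (x : Pt d) (r : ℕ) : Set (Pt d) := {y | ninf x y ≤ r}

/-- a skeleton: a set of indices at the finest scale satisfying the Wiener-type
spacing conditions -/
def IsSkeleton (L L₀ : ℕ) (M : Finset (Pt d)) : Prop :=
  ∀ m₀ ∈ M,
    (∀ h : ℕ,
      {m : Pt d | m ∈ M ∧
        dInfLE (boxC L L₀ 0 m₀) (boxC L L₀ 0 m) (L * Lscale L L₀ (h + 1)) ∧
        ¬ dInfLE (boxC L L₀ 0 m₀) (boxC L L₀ 0 m) (L * Lscale L L₀ h)}.ncard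
        ≤ 2 ^ (h + 1)) ∧
    ∀ m ∈ M, m ≠ m₀ → ¬ dInfLE (boxC L L₀ 0 m₀) (boxC L L₀ 0 m) (L * Lscale L L₀ 0)

theorem ninf_le_iff {x y : Pt d} {r : ℕ} : ninf x y ≤ r ↔ ∀ k, (x k - y k).natAbs ≤ r := by
  simp [ninf]

theorem adj_iff {x y : Pt d} :
    adj x y ↔ ∃ k, (x k - y k).natAbs = 1 ∧ ∀ i, i ≠ k → x i = y i := by
  unfold adj n1
  constructor
  · intro h
    obtain ⟨k, hk⟩ : ∃ k, (x k - y k).natAbs ≠ 0 := by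
      by_contra! hc
      simp [hc] at h
    rw [← Finset.add_sum_erase _ _ (Finset.mem_univ k)] at h
    have h0 : ∑ j ∈ Finset.univ.erase k, (x j - y j).natAbs = 0 := by omega
    refine ⟨k, by omega, fun i hi => ?_⟩
    have := Finset.sum_eq_zero_iff.1 h0 i (by simp [hi])
    omega
  · rintro ⟨k, hk, h⟩
    rw [Finset.sum_eq_single k (fun i _ hi => by simp [h i hi]) (by simp), hk]

theorem adj_comm {x y : Pt d} : adj x y ↔ adj y x := by
  have h : ∀ {x y : Pt d}, adj x y → adj y x := fun {x y} h => by
    obtain ⟨k, hk, h⟩ := adj_iff.1 h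
    exact adj_iff.2 ⟨k, by omega, fun i hi => (h i hi).symm⟩
  exact ⟨h, h⟩

theorem adj_add_single (x : Pt d) (k : Fin d) : adj x (x + Pi.single k 1) :=
  adj_iff.2 ⟨k, by simp, fun i hi => by simp [hi]⟩

theorem adj.ninf_le {x y : Pt d} (h : adj x y) : ninf x y ≤ 1 := by
  obtain ⟨k, hk, h⟩ := adj_iff.1 h
  refine ninf_le_iff.2 fun i => ?_
  by_cases hi : i = k
  · subst hi; omega
  · simp [h i hi]

theorem adj.eq_add_single {x y : Pt d} (h : adj x y) :
    ∃ k, y = x + Pi.single k 1 ∨ x = y + Pi.single k 1 := by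
  obtain ⟨k, hk, h⟩ := adj_iff.1 h
  refine ⟨k, ?_⟩
  rcases Int.natAbs_eq_iff.1 hk with hk | hk
  · right
    ext i
    by_cases hi : i = k
    · subst hi; simp at hk ⊢; omega
    · simp [hi, h i hi]
  · left
    ext i
    by_cases hi : i = k
    · subst hi; simp at hk ⊢; omega
    · simp [hi, h i hi]

namespace ConnIn

variable {U W : Set (Pt d)} {x y z : Pt d}

theorem refl (hx : x ∈ U) : ConnIn U x x :=
  ⟨fun _ => x, 0, fun l hl => by omega, rfl, rfl, fun _ _ => hx⟩

theorem left_mem (h : ConnIn U x y) : x ∈ U := by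
  obtain ⟨τ, N, -, rfl, -, h⟩ := h
  exact h 0 (Nat.zero_le _)

theorem right_mem (h : ConnIn U x y) : y ∈ U := by
  obtain ⟨τ, N, -, -, rfl, h⟩ := h
  exact h N le_rfl

theorem mono (hUW : U ⊆ W) (h : ConnIn U x y) : ConnIn W x y := by
  obtain ⟨τ, N, hp, h0, hN, h⟩ := h
  exact ⟨τ, N, hp, h0, hN, fun l hl => hUW (h l hl)⟩

theorem tail (h : ConnIn U x y) (hyz : adj y z) (hz : z ∈ U) : ConnIn U x z := by
  obtain ⟨τ, N, hp, rfl, rfl, h⟩ := h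
  refine ⟨fun l => if l ≤ N then τ l else z, N + 1, fun l hl => ?_, by simp, by simp,
    fun l _ => ?_⟩
  · rcases Nat.lt_succ_iff_lt_or_eq.1 hl with hl | rfl
    · simpa [hl.le, Nat.succ_le_of_lt hl] using hp l hl
    · simpa using hyz
  · by_cases hlN : l ≤ N
    · simpa [hlN] using h l hlN
    · simpa [hlN] using hz

theorem induct {P : Pt d → Prop} (h : ConnIn U x y) (h0 : P x)
    (hs : ∀ a b, ConnIn U x a → adj a b → b ∈ U → P a → P b) : P y := by
  obtain ⟨τ, N, hp, rfl, rfl, h⟩ := h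
  have key : ∀ l ≤ N, P (τ l) := by
    intro l
    induction l with
    | zero => exact fun _ => h0
    | succ l ih =>
      intro hl
      exact hs _ _ ⟨τ, l, fun k hk => hp k (by omega), rfl, rfl, fun k hk => h k (by omega)⟩
        (hp l (by omega)) (h _ hl) (ih (by omega))
  exact key N le_rfl

theorem trans (h : ConnIn U x y) (h' : ConnIn U y z) : ConnIn U x z :=
  h'.induct h fun _ _ _ hab hb ih => ih.tail hab hb

theorem symm (h : ConnIn U x y) : ConnIn U y x :=
  h.induct (P := fun z => ConnIn U z x) (refl h.left_mem) fun _ _ ha hab hb ih =>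
    ((refl hb).tail (adj_comm.1 hab) ha.right_mem).trans ih

end ConnIn

theorem connSet_comp (U : Set (Pt d)) (x : Pt d) : ConnSet (comp U x) := by
  intro a ha b hb
  have key : ∀ {c}, ConnIn U x c → ConnIn (comp U x) x c := fun {c} hc =>
    hc.induct (ConnIn.refl (ConnIn.refl hc.left_mem)) fun a b ha hab hb ih =>
      ih.tail hab (ha.tail hab hb)
  exact (key ha).symm.trans (key hb)

/-- Points are connected through any set containing the box that they span. -/
theorem connIn_of_box_subset {U : Set (Pt d)} (x y : Pt d)
    (h : ∀ z : Pt d, (∀ k, min (x k) (y k) ≤ z k ∧ z k ≤ max (x k) (y k)) → z ∈ U) :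
    ConnIn U x y := by
  induction hn : n1 x y using Nat.strong_induction_on generalizing x with
  | _ N ih =>
  subst hn
  have hx : x ∈ U := h x fun k => by omega
  by_cases hxy : x = y
  · subst hxy
    exact ConnIn.refl hx
  obtain ⟨k, hk⟩ := Function.ne_iff.1 hxy
  obtain ⟨s, hs1, hs2⟩ : ∃ s : ℤ, s.natAbs = 1 ∧
      (x k + s - y k).natAbs < (x k - y k).natAbs := by
    rcases lt_or_gt_of_ne hk with hk | hk
    · exact ⟨1, by simp, by omega⟩
    · exact ⟨-1, by simp, by omega⟩
  have hlt : n1 (Function.update x k (x k + s)) y < n1 x y := by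
    refine Finset.sum_lt_sum (fun i _ => ?_) ⟨k, Finset.mem_univ k, by simpa using hs2⟩
    by_cases hi : i = k
    · subst hi; simpa using hs2.le
    · simp [hi]
  have hbox : ∀ i, min (x i) (y i) ≤ Function.update x k (x k + s) i ∧
      Function.update x k (x k + s) i ≤ max (x i) (y i) := by
    intro i
    by_cases hi : i = k
    · subst hi; simp only [Function.update_self]; omega
    · simp [hi]
  have hrest := ih _ hlt (Function.update x k (x k + s))
    (fun z hz => h z fun i => by have := hz i; have := hbox i; omega) rfl
  refine ((ConnIn.refl hx).tail (adj_iff.2 ⟨k, by simpa using hs1, fun i hi => ?_⟩)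
    hrest.left_mem).trans hrest
  simp [hi]

/-- A closed `1`-cochain on `ℤ^ι` with coefficients in an abelian group is exact. -/
theorem exists_potential {ι A : Type*} [Fintype ι] [DecidableEq ι] [AddCommGroup A]
    (f : (ι → ℤ) → ι → A)
    (hf : ∀ x k m, f x k + f (x + Pi.single k 1) m = f x m + f (x + Pi.single m 1) k) :
    ∃ φ : (ι → ℤ) → A, ∀ x k, φ (x + Pi.single k 1) = φ x + f x k := by
  have hint : ∀ g : ℤ → A, ∃ G : ℤ → A, ∀ t, G (t + 1) = G t + g t := by
    intro g
    refine ⟨fun t => ∑ s ∈ Finset.Ico 0 t, g s - ∑ s ∈ Finset.Ico t 0, g s, fun t => ?_⟩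
    rcases le_or_gt 0 t with ht | ht
    · have h1 : Finset.Ico (t + 1) 0 = ∅ := Finset.Ico_eq_empty (by omega)
      have h2 : Finset.Ico t 0 = ∅ := Finset.Ico_eq_empty (by omega)
      have h3 : Finset.Ico 0 (t + 1) = insert t (Finset.Ico 0 t) := by ext; simp; omega
      simp only [h1, h2, h3]
      rw [Finset.sum_insert (by simp)]
      simp [add_comm]
    · have h1 : Finset.Ico 0 (t + 1) = ∅ := Finset.Ico_eq_empty (by omega)
      have h2 : Finset.Ico 0 t = ∅ := Finset.Ico_eq_empty (by omega)
      have h3 : Finset.Ico t 0 = insert t (Finset.Ico (t + 1) 0) := by ext; simp; omega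
      simp only [h1, h2, h3]
      rw [Finset.sum_insert (by simp)]
      simp
  choose I hI using hint
  suffices h : ∀ s : Finset ι, ∃ φ : (ι → ℤ) → A, ∀ k ∈ s, ∀ x,
      φ (x + Pi.single k 1) = φ x + f x k by
    obtain ⟨φ, hφ⟩ := h Finset.univ
    exact ⟨φ, fun x k => hφ k (Finset.mem_univ k) x⟩
  intro s
  induction s using Finset.induction_on with
  | empty => exact ⟨fun _ => 0, by simp⟩
  | insert m s hm ih =>
    obtain ⟨φ, hφ⟩ := ih
    let g : (ι → ℤ) → A := fun x => f x m - (φ (x + Pi.single m 1) - φ x)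
    have hg : ∀ k ∈ s, ∀ x, g (x + Pi.single k 1) = g x := by
      intro k hk x
      have h1 := hf x k m
      have h2 := hφ k hk x
      have h3 := hφ k hk (x + Pi.single m 1)
      have h4 : x + Pi.single k 1 + Pi.single m 1 = x + Pi.single m 1 + Pi.single k (1 : ℤ) :=
        add_right_comm _ _ _
      simp only [g, h4, h2, h3]
      have h5 : f (x + Pi.single k 1) m = f x m + f (x + Pi.single m 1) k - f x k := by
        rw [← h1]; abel
      rw [h5]; abel
    refine ⟨fun x => φ x + I (fun t => g (Function.update x m t)) (x m), fun k hk x => ?_⟩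
    by_cases hkm : k = m
    · subst hkm
      have h1 : ∀ t, Function.update (x + Pi.single k 1) k t = Function.update x k t := by
        intro t; ext i
        by_cases hi : i = k
        · subst hi; simp
        · simp [hi]
      simp only [h1, Pi.add_apply, Pi.single_eq_same, hI, Function.update_eq_self]
      simp only [g]; abel
    · have hks : k ∈ s := (Finset.mem_insert.1 hk).resolve_left hkm
      have h1 : ∀ t, Function.update (x + Pi.single k 1) m t =
          Function.update x m t + Pi.single k 1 := by
        intro t; ext i
        by_cases hi : i = m
        · subst hi; simp [Ne.symm hkm]
        · simp [hi]
      simp only [h1, hg k hks, hφ k hks]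
      simp [Ne.symm hkm]
      abel

open Classical in
/-- The `ℤ/2`-valued indicator of a set. -/
noncomputable def ind (A : Set (Pt d)) (x : Pt d) : ZMod 2 := if x ∈ A then 1 else 0

theorem ind_of_mem {A : Set (Pt d)} {x : Pt d} (h : x ∈ A) : ind A x = 1 := if_pos h

theorem ind_of_notMem {A : Set (Pt d)} {x : Pt d} (h : x ∉ A) : ind A x = 0 := if_neg h

theorem edge_indicator_eq {D U : Set (Pt d)} {a b : Pt d} (ha : a ∈ D → a ∉ U)
    (hb : b ∈ D → b ∉ U) (hab : a ∈ D → b ∉ U → b ∈ D) (hba : b ∈ D → a ∉ U → a ∈ D) :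
    ind D a * ind U b + ind U a * ind D b = ind D b - ind D a := by
  simp only [ind]
  by_cases a1 : a ∈ D <;> by_cases b1 : b ∈ D <;>
    by_cases a2 : a ∈ U <;> by_cases b2 : b ∈ U <;> simp_all

/-- The indicator of the edges between `D` and `U` has a potential, provided that near `U`
one cannot leave `D` without entering `U`. -/
theorem exists_edge_potential {D U : Set (Pt d)} (hDU : ∀ z ∈ D, z ∉ U)
    (h : ∀ a b, adj a b → a ∈ D → b ∉ U → (∃ u ∈ U, ninf u b ≤ 1) → b ∈ D) :
    ∃ φ : Pt d → ZMod 2, ∀ a b, adj a b →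
      φ b = φ a + (ind D a * ind U b + ind U a * ind D b) := by
  obtain ⟨φ, hφ⟩ := exists_potential (A := ZMod 2)
    (fun (x : Pt d) k => ind D x * ind U (x + Pi.single k 1) + ind U x * ind D (x + Pi.single k 1))
    (by
      intro x k m
      have hcomm : x + Pi.single m 1 + Pi.single k 1 = x + Pi.single k 1 + Pi.single m (1 : ℤ) :=
        add_right_comm _ _ _
      rw [hcomm]
      by_cases hkm : k = m
      · subst hkm; rfl
      have e1 : adj x (x + Pi.single k 1) := adj_add_single _ _
      have e2 : adj x (x + Pi.single m 1) := adj_add_single _ _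
      have e3 : adj (x + Pi.single k 1) (x + Pi.single k 1 + Pi.single m 1) := adj_add_single _ _
      have e4 : adj (x + Pi.single m 1) (x + Pi.single k 1 + Pi.single m 1) := by
        rw [← hcomm]; exact adj_add_single _ _
      have hbd : ∀ i : Fin d, 0 ≤ (Pi.single k 1 : Pt d) i ∧ 0 ≤ (Pi.single m 1 : Pt d) i ∧
          (Pi.single k 1 : Pt d) i + (Pi.single m 1 : Pt d) i ≤ 1 := by
        intro i
        by_cases hi : i = k
        · subst hi; simp [hkm]
        · by_cases hi' : i = m
          · subst hi'; simp [hi]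
          · simp [hi, hi']
      generalize ha : x + Pi.single k 1 = a at *
      generalize hb : x + Pi.single m 1 = b at *
      generalize hc : a + Pi.single m 1 = c at *
      have near : ∀ p q : Pt d, (p = x ∨ p = a ∨ p = b ∨ p = c) →
          (q = x ∨ q = a ∨ q = b ∨ q = c) → ninf p q ≤ 1 := by
        intro p q hp hq
        refine ninf_le_iff.2 fun i => ?_
        have h1 := hbd i
        have h2 := congrFun ha i
        have h3 := congrFun hb i
        have h4 := congrFun hc i
        simp only [Pi.add_apply] at h2 h3 h4
        rcases hp with rfl | rfl | rfl | rfl <;> rcases hq with rfl | rfl | rfl | rfl <;> omega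
      by_cases hU : ∃ u, (u = x ∨ u = a ∨ u = b ∨ u = c) ∧ u ∈ U
      · obtain ⟨u, hu, huU⟩ := hU
        have key : ∀ p q, (q = x ∨ q = a ∨ q = b ∨ q = c) → adj p q →
            p ∈ D → q ∉ U → q ∈ D :=
          fun p q hq hpq hpD hqU => h p q hpq hpD hqU ⟨u, huU, near u q hu hq⟩
        have edge : ∀ p q, (p = x ∨ p = a ∨ p = b ∨ p = c) → (q = x ∨ q = a ∨ q = b ∨ q = c) →
            adj p q → ind D p * ind U q + ind U p * ind D q = ind D q - ind D p :=
          fun p q hp hq hpq => edge_indicator_eq (hDU p) (hDU q) (key p q hq hpq)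
            (key q p hp (adj_comm.1 hpq))
        rw [edge x a (by simp) (by simp) e1, edge a c (by simp) (by simp) e3,
          edge x b (by simp) (by simp) e2, edge b c (by simp) (by simp) e4]
        abel
      · push Not at hU
        simp [ind_of_notMem (hU x (by simp)), ind_of_notMem (hU a (by simp)),
          ind_of_notMem (hU b (by simp)), ind_of_notMem (hU c (by simp))])
  refine ⟨φ, fun a b hab => ?_⟩
  obtain ⟨k, rfl | rfl⟩ := hab.eq_add_single
  · exact hφ a k
  · rw [hφ b k, add_assoc, mul_comm (ind D (b + _)), mul_comm (ind U (b + _)),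
      add_comm (ind U b * _), CharTwo.add_self_eq_zero, add_zero]

/-- Mutually distant sets `U j` that individually do not separate `x` from `y` do not separate
them jointly, even inside `C`, if those met by some connection of `x` to `y` lie well inside `C`. -/
theorem connIn_diff_iUnion {J : ℕ} {U : ℕ → Set (Pt d)} {C T : Set (Pt d)} {x y : Pt d}
    (hfar : ∀ i < J, ∀ j < J, i ≠ j → farInf (U i) (U j)) (hTC : T ⊆ C)
    (hdeep : ∀ j < J, (∃ z ∈ T, z ∈ U j) → ∀ u ∈ U j, ∀ v, ninf u v ≤ 1 → v ∈ C)
    (hx : ∀ j < J, x ∉ U j) (hT : ConnIn T x y)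
    (hU : ∀ j < J, ConnIn (U j)ᶜ x y) :
    ConnIn {z | z ∈ C ∧ ∀ j < J, z ∉ U j} x y := by
  set E : Set (Pt d) := {z | z ∈ C ∧ ∀ j < J, z ∉ U j}
  set D := comp E x
  have hDE : ∀ z ∈ D, z ∈ E := fun z hz => ConnIn.right_mem hz
  have hDstep : ∀ a b, adj a b → a ∈ D → b ∈ E → b ∈ D :=
    fun a b hab ha hb => ConnIn.tail ha hab hb
  have hpot : ∀ j, ∃ φ : Pt d → ZMod 2, j < J → φ x = φ y ∧
      ∀ a ∈ T, ∀ b ∈ T, adj a b →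
        φ b = φ a + (ind D a * ind (U j) b + ind (U j) a * ind D b) := by
    intro j
    by_cases hjT : j < J ∧ ∃ z ∈ T, z ∈ U j
    · obtain ⟨hj, hz⟩ := hjT
      obtain ⟨φ, hφ⟩ := exists_edge_potential (D := D) (U := U j)
        (fun z hz => (hDE z hz).2 j hj) (by
          rintro a b hab ha hb ⟨u, hu, hub⟩
          refine hDstep a b hab ha ⟨hdeep j hj hz u hu b hub, fun i hi hbi => ?_⟩
          by_cases hij : i = j
          · exact hb (hij ▸ hbi)
          · exact absurd (hfar j hj i hi (Ne.symm hij) u hu b hbi) (by omega))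
      refine ⟨φ, fun _ => ⟨?_, fun a _ b _ hab => hφ a b hab⟩⟩
      refine (hU j hj).induct (P := fun z => φ x = φ z) rfl fun a b ha hab hb ih => ?_
      rw [hφ a b hab, ind_of_notMem ha.right_mem, ind_of_notMem hb, ih]
      simp
    · refine ⟨fun _ => 0, fun hj => ⟨rfl, fun a ha b hb _ => ?_⟩⟩
      have hno : ∀ z ∈ T, z ∉ U j := fun z hz hzU => hjT ⟨hj, z, hz, hzU⟩
      simp [ind_of_notMem (hno a ha), ind_of_notMem (hno b hb)]
  choose φ hφ using hpot
  set W : Set (Pt d) := {z | ∃ j < J, z ∈ U j}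
  have hind : ∀ z, ∑ j ∈ Finset.range J, ind (U j) z = ind W z := by
    intro z
    by_cases hz : ∃ j < J, z ∈ U j
    · rw [ind_of_mem (by exact hz)]
      obtain ⟨j, hj, hz⟩ := hz
      rw [Finset.sum_eq_single j, ind_of_mem hz]
      · intro i hi hij
        refine ind_of_notMem fun hzi => ?_
        have := hfar i (Finset.mem_range.1 hi) j hj hij z hzi z hz
        simp [ninf] at this
      · exact fun hj' => absurd (Finset.mem_range.2 hj) hj'
    · rw [ind_of_notMem (by exact hz)]
      exact Finset.sum_eq_zero fun j hj =>
        ind_of_notMem fun hzj => hz ⟨j, Finset.mem_range.1 hj, hzj⟩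
  have hxT := hT.left_mem
  have hxD : x ∈ D := ConnIn.refl ⟨hTC hxT, hx⟩
  have hsum : ∑ j ∈ Finset.range J, φ j y - ind D y = ∑ j ∈ Finset.range J, φ j x - ind D x := by
    refine hT.induct (P := fun z => ∑ j ∈ Finset.range J, φ j z - ind D z =
      ∑ j ∈ Finset.range J, φ j x - ind D x) rfl fun a b ha hab hb ih => ?_
    rw [← ih, Finset.sum_congr rfl fun j hj =>
      (hφ j (Finset.mem_range.1 hj)).2 a ha.right_mem b hb hab, Finset.sum_add_distrib,
      Finset.sum_add_distrib, ← Finset.mul_sum, ← Finset.sum_mul, hind, hind]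
    have haC := hTC ha.right_mem
    have hbC := hTC hb
    suffices ind D a * ind W b + ind W a * ind D b = ind D b - ind D a by rw [this]; abel
    have mem : ∀ z ∈ C, z ∉ W → z ∈ E := fun z hz h => ⟨hz, fun j hj hzj => h ⟨j, hj, hzj⟩⟩
    have nmem : ∀ z ∈ D, z ∉ W := fun z hz ⟨j, hj, hzj⟩ => (hDE z hz).2 j hj hzj
    exact edge_indicator_eq (nmem a) (nmem b) (fun h h' => hDstep a b hab h (mem b hbC h'))
      fun h h' => hDstep b a (adj_comm.1 hab) h (mem a haC h')
  rw [Finset.sum_congr rfl fun j hj => (hφ j (Finset.mem_range.1 hj)).1, ind_of_mem hxD] at hsum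
  by_contra hy
  have hy' : y ∉ D := hy
  rw [ind_of_notMem hy', sub_right_inj] at hsum
  exact zero_ne_one hsum

/-- A connection can be rerouted around isolated points `P`. -/
theorem connIn_reroute {C C' V V' P : Set (Pt d)} {y z : Pt d}
    (hV : ∀ z ∈ V, z ∈ V' ∨ z ∈ P) (hC : ∀ p ∈ C', ∀ r, ninf p r ≤ 1 → r ∈ C)
    (hring : ∀ p ∈ P, ∀ r r', adj p r → adj p r' → r ∉ V' → r' ∉ V' →
      ConnIn {q | ninf p q ≤ 1 ∧ q ∉ V} r r')
    (hPV : P ⊆ V) (hy : y ∉ V) (h : ConnIn (C' \ V') y z) :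
    (z ∉ P → ConnIn (C \ V) y z) ∧
      (z ∈ P → ∀ r, adj z r → r ∉ V' → ConnIn (C \ V) y r) := by
  have hCC : ∀ p ∈ C', p ∈ C := fun p hp => hC p hp p (by simp [ninf])
  have hring' : ∀ p ∈ C', p ∈ P → ∀ r r', adj p r → adj p r' → r ∉ V' → r' ∉ V' →
      ConnIn (C \ V) r r' := fun p hpC hp r r' h1 h2 h3 h4 =>
    (hring p hp r r' h1 h2 h3 h4).mono fun q hq => ⟨hC p hpC q hq.1, hq.2⟩
  refine h.induct (P := fun z => (z ∉ P → ConnIn (C \ V) y z) ∧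
    (z ∈ P → ∀ r, adj z r → r ∉ V' → ConnIn (C \ V) y r)) ?_ ?_
  · exact ⟨fun _ => ConnIn.refl ⟨hCC y h.left_mem.1, hy⟩, fun hyP => absurd (hPV hyP) hy⟩
  · rintro a b ha hab hb ⟨ih1, ih2⟩
    by_cases haP : a ∈ P
    · have hyb := ih2 haP b hab hb.2
      exact ⟨fun _ => hyb, fun hbP => absurd (hPV hbP) hyb.right_mem.2⟩
    · have hya := ih1 haP
      refine ⟨fun hbP => hya.tail hab ⟨hCC b hb.1, fun hbV => (hV b hbV).elim hb.2 hbP⟩, ?_⟩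
      exact fun hbP r hbr hr => hya.trans
        (hring' b hb.1 hbP a r (adj_comm.1 hab) hbr ha.right_mem.2 hr)

theorem subset_fill (V : Set (Pt d)) : V ⊆ fill V :=
  fun _ hz _ hzS hSV _ => absurd hz (hSV hzS)

theorem fill_mono {V W : Set (Pt d)} (h : V ⊆ W) : fill V ⊆ fill W :=
  fun _ hz S hzS hSW hS => hz S hzS (fun _ hs hsV => hSW hs (h hsV)) hS

theorem notMem_fill_of_connIn {V : Set (Pt d)} {x y : Pt d} (hx : x ∉ fill V)
    (h : ConnIn Vᶜ x y) : y ∉ fill V := by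
  intro hy
  refine hx fun S hxS hSV hS => ?_
  refine (hy (comp Vᶜ x) h (fun z hz => ConnIn.right_mem hz) (connSet_comp _ _)).subset ?_
  exact fun s hs => (hS x hxS s hs).mono hSV

theorem infinite_of_forall_update_mem {S : Set (Pt d)} (z : Pt d) (k : Fin d) (s : ℤ) (hs : s ≠ 0)
    (h : ∀ t : ℕ, Function.update z k (z k + s * t) ∈ S) : S.Infinite := by
  refine Set.infinite_of_injective_forall_mem
    (f := fun t : ℕ => Function.update z k (z k + s * t)) (fun t t' htt => ?_) h
  simpa [hs] using congrFun htt k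

theorem exists_le_of_mem_fill {U : Set (Pt d)} {z : Pt d} (hz : z ∈ fill U) (k : Fin d) :
    ∃ u ∈ U, z k ≤ u k := by
  by_contra! hU
  refine infinite_of_forall_update_mem z k 1 one_ne_zero (fun t => ?_)
    (hz {v | z k ≤ v k} (by simp) (fun v hv hvU => absurd (hU v hvU) (not_lt.2 hv))
      fun x hx y hy => connIn_of_box_subset x y fun v hv => ?_)
  · simp
  · have := hv k
    simp only [Set.mem_ofPred_eq] at hx hy ⊢
    omega

theorem exists_ge_of_mem_fill {U : Set (Pt d)} {z : Pt d} (hz : z ∈ fill U) (k : Fin d) :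
    ∃ u ∈ U, u k ≤ z k := by
  by_contra! hU
  refine infinite_of_forall_update_mem z k (-1) (by simp) (fun t => ?_)
    (hz {v | v k ≤ z k} (by simp) (fun v hv hvU => absurd (hU v hvU) (not_lt.2 hv))
      fun x hx y hy => connIn_of_box_subset x y fun v hv => ?_)
  · simp
  · have := hv k
    simp only [Set.mem_ofPred_eq] at hx hy ⊢
    omega

theorem ninf_le_of_mem_fill {U : Set (Pt d)} {r : ℕ} (hU : ∀ u ∈ U, ∀ v ∈ U, ninf u v ≤ r)
    {x y : Pt d} (hx : x ∈ fill U) (hy : y ∈ fill U) : ninf x y ≤ r := by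
  refine ninf_le_iff.2 fun k => ?_
  obtain ⟨a, ha, hxa⟩ := exists_le_of_mem_fill hx k
  obtain ⟨b, hb, hbx⟩ := exists_ge_of_mem_fill hx k
  obtain ⟨a', ha', hya⟩ := exists_le_of_mem_fill hy k
  obtain ⟨b', hb', hby⟩ := exists_ge_of_mem_fill hy k
  have h1 := ninf_le_iff.1 (hU a ha b' hb') k
  have h2 := ninf_le_iff.1 (hU a' ha' b hb) k
  omega

/-- The complement of a finite set has a unique infinite connected component. -/
theorem exists_hub (hd : 2 ≤ d) {V : Set (Pt d)} (hV : V.Finite) :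
    ∃ y, y ∉ fill V ∧ ∀ x, x ∉ fill V → ConnIn Vᶜ x y := by
  obtain ⟨b, hb⟩ := hV.bddAbove
  obtain ⟨a, ha⟩ := hV.bddBelow
  have hout : ∀ (v : Pt d) (k : Fin d), v k < a k ∨ b k < v k → v ∈ Vᶜ := by
    intro v k hv hvV
    have h1 : v k ≤ b k := hb hvV k
    have h2 : a k ≤ v k := ha hvV k
    omega
  let k0 : Fin d := ⟨0, by omega⟩
  have : Nontrivial (Fin d) := Fin.nontrivial_iff_two_le.2 hd
  refine ⟨fun i => b i + 1, fun hfill => ?_, fun x hx => ?_⟩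
  · obtain ⟨u, hu, h⟩ := exists_le_of_mem_fill hfill k0
    have : u k0 ≤ b k0 := hb hu k0
    omega
  · simp only [fill, Set.mem_ofPred_eq, not_forall] at hx
    obtain ⟨S, hxS, hSV, hS, hfin⟩ := hx
    obtain ⟨z, hzS, hz⟩ := Set.not_subset.1 fun h : S ⊆ Set.Icc a b =>
      hfin ((Set.finite_Icc a b).subset h)
    obtain ⟨k, hk⟩ : ∃ k, z k < a k ∨ b k < z k := by
      by_contra! hc
      exact hz ⟨fun i => (hc i).1, fun i => (hc i).2⟩
    obtain ⟨m, hm⟩ := exists_ne k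
    refine (((hS x hxS z hzS).mono hSV).trans
      (connIn_of_box_subset z (Function.update (fun i => b i + 1) k (z k)) fun v hv =>
        hout v k ?_)).trans (connIn_of_box_subset _ _ fun v hv => hout v m ?_)
    · have := hv k
      simp only [Function.update_self] at this
      omega
    · have := hv m
      simp only [Function.update_of_ne hm] at this
      omega

theorem connIn_compl_of_notMem_fill (hd : 2 ≤ d) {V : Set (Pt d)} (hV : V.Finite) {x y : Pt d}
    (hx : x ∉ fill V) (hy : y ∉ fill V) : ConnIn Vᶜ x y := by
  obtain ⟨z, -, hz⟩ := exists_hub hd hV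
  exact (hz x hx).trans (hz y hy).symm

theorem subset_fill_of_bd_subset_fill {A V : Set (Pt d)} (hA : A.Finite) (h : bd A ⊆ fill V) :
    A ⊆ fill V := by
  intro a ha S haS hSV hS
  by_contra hinf
  obtain ⟨s, hs, hsA⟩ := Set.not_subset.1 fun h : S ⊆ A => hinf (hA.subset h)
  have key : s ∈ A ∨ ∃ b ∈ S, b ∈ bd A := by
    refine (hS a haS s hs).induct (P := fun z => z ∈ A ∨ ∃ b ∈ S, b ∈ bd A) (Or.inl ha) ?_
    rintro p q - hpq hq (hp | hp)
    · by_cases hqA : q ∈ A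
      · exact Or.inl hqA
      · exact Or.inr ⟨q, hq, hqA, p, hp, adj_comm.1 hpq⟩
    · exact Or.inr hp
  obtain ⟨b, hbS, hb⟩ := key.resolve_left hsA
  exact hinf (h hb S hbS hSV hS)

/-- A connected set that is larger than each of the `U j` has a boundary point outside the
filling of the chain `V` formed by the `U j` and the isolated points `P`. -/
theorem exists_bd_notMem_fill (hd : 2 ≤ d) {J r : ℕ} {U : ℕ → Set (Pt d)} {V P A : Set (Pt d)}
    (hVfin : V.Finite) (hV : ∀ z ∈ V, z ∈ {z | ∃ j < J, z ∈ U j} ∨ z ∈ P)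
    (hUV : ∀ j < J, U j ⊆ V) (hPV : P ⊆ V)
    (hfar : ∀ i < J, ∀ j < J, i ≠ j → farInf (U i) (U j))
    (hring : ∀ p ∈ P, ∀ r r', adj p r → adj p r' → r ∉ {z | ∃ j < J, z ∈ U j} →
      r' ∉ {z | ∃ j < J, z ∈ U j} → ConnIn {q | ninf p q ≤ 1 ∧ q ∉ V} r r')
    (hPnbr : ∀ p ∈ P, ∃ r, adj p r ∧ r ∉ {z | ∃ j < J, z ∈ U j})
    (hUfill : ∀ i < J, ∀ j < J, i ≠ j → ∀ u ∈ U i, u ∉ fill (U j))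
    (hdiam : ∀ j < J, ∀ u ∈ U j, ∀ v ∈ U j, ninf u v ≤ r)
    (hAfin : A.Finite) (hA : ConnSet A) (hAdiam : ∃ a ∈ A, ∃ b ∈ A, r < ninf a b) :
    ∃ x ∈ bd A, x ∉ fill V := by
  by_contra! hbd
  have hAV := subset_fill_of_bd_subset_fill hAfin hbd
  obtain ⟨y, hy, -⟩ := exists_hub hd hVfin
  have hyV : y ∉ V := fun h => hy (subset_fill V h)
  have hcover : ∀ a ∈ A, ∃ j < J, a ∈ fill (U j) := by
    intro a ha
    by_contra! hc
    have hconn := connIn_diff_iUnion (C := Set.univ) (T := Set.univ) (x := y) (y := a) hfar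
      (Set.subset_univ _) (fun _ _ _ _ _ _ _ => Set.mem_univ _)
      (fun j hj h => hyV (hUV j hj h))
      (connIn_of_box_subset _ _ fun _ _ => Set.mem_univ _)
      (fun j hj => connIn_compl_of_notMem_fill hd (hVfin.subset (hUV j hj))
        (fun h => hy (fill_mono (hUV j hj) h)) (hc j hj))
    obtain ⟨h1, h2⟩ := connIn_reroute (C := Set.univ) (C' := Set.univ) hV
      (fun _ _ _ _ => Set.mem_univ _) hring hPV hyV
      (hconn.mono fun z hz => ⟨hz.1, fun ⟨j, hj, hzj⟩ => hz.2 j hj hzj⟩)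
    have hsub : (Set.univ \ V : Set (Pt d)) ⊆ Vᶜ := fun z hz => hz.2
    by_cases haP : a ∈ P
    · obtain ⟨r, har, hr⟩ := hPnbr a haP
      have hr' := notMem_fill_of_connIn hy ((h2 haP r har hr).mono hsub)
      by_cases hrA : r ∈ A
      · exact hr' (hAV hrA)
      · exact hr' (hbd r ⟨hrA, a, ha, adj_comm.1 har⟩)
    · exact notMem_fill_of_connIn hy ((h1 haP).mono hsub) (hAV ha)
  obtain ⟨a, ha, b, hb, hab⟩ := hAdiam
  obtain ⟨i, hi, hai⟩ := hcover a ha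
  have hbi : b ∈ fill (U i) := by
    refine (hA a ha b hb).induct (P := fun z => z ∈ fill (U i)) hai fun p q hp hpq hq ih => ?_
    by_contra hqi
    have hpU : p ∈ U i := by
      by_contra hpU
      refine notMem_fill_of_connIn hqi ((ConnIn.refl ?_).tail (adj_comm.1 hpq) hpU) ih
      exact fun h => hqi (subset_fill _ h)
    obtain ⟨j, hj, hqj⟩ := hcover q hq
    have hij : i ≠ j := fun h => hqi (h ▸ hqj)
    have hpj := hUfill i hi j hj hij p hpU
    have hqU : q ∈ U j := by
      by_contra hqU
      refine notMem_fill_of_connIn hpj ((ConnIn.refl ?_).tail hpq hqU) hqj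
      exact fun h => hpj (subset_fill _ h)
    exact absurd (hfar i hi j hj hij p hpU q hqU) (not_lt.2 hpq.ninf_le)
  exact absurd (ninf_le_of_mem_fill (hdiam i hi) hai hbi) (not_le.2 hab)

/-- Two neighbors of `p` at distance more than `1` lie on opposite sides of `p`. -/
theorem opposite_neighbors {p a b : Pt d} (ha : adj p a) (hb : adj p b) (hab : 1 < ninf a b) :
    ∃ k, (∀ q, adj p q → q = a ∨ q = b ∨ q k = p k) ∧
      (∀ q, q k = p k → ninf p q ≤ 1 → ninf q a ≤ 1 ∧ ninf q b ≤ 1) := by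
  obtain ⟨k, hk⟩ : ∃ k, 1 < (a k - b k).natAbs := by
    by_contra! hc
    exact absurd (ninf_le_iff.2 hc) (not_le.2 hab)
  obtain ⟨i, hi1, hi2⟩ := adj_iff.1 ha
  obtain ⟨j, hj1, hj2⟩ := adj_iff.1 hb
  have hik : k = i := by
    by_contra h
    have := hi2 k h
    have := ninf_le_iff.1 hb.ninf_le k
    omega
  have hjk : k = j := by
    by_contra h
    have := hj2 k h
    have := ninf_le_iff.1 ha.ninf_le k
    omega
  subst hik
  subst hjk
  refine ⟨k, fun q hq => ?_, fun q hqk hq => ⟨ninf_le_iff.2 fun i => ?_, ninf_le_iff.2 fun i => ?_⟩⟩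
  · obtain ⟨m, hm1, hm2⟩ := adj_iff.1 hq
    by_cases hmk : k = m
    · subst hmk
      have : q k = a k ∨ q k = b k := by omega
      refine this.imp (fun h => ?_) fun h => Or.inl ?_
      · ext i
        by_cases hi : i = k
        · rw [hi, h]
        · rw [← hi2 i hi, ← hm2 i hi]
      · ext i
        by_cases hi : i = k
        · rw [hi, h]
        · rw [← hj2 i hi, ← hm2 i hi]
    · exact Or.inr (Or.inr (hm2 k hmk).symm)
  all_goals
    by_cases hi : i = k
    · subst hi; omega
    · have := ninf_le_iff.1 hq i
      have := hi2 i hi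
      have := hj2 i hi
      omega

/-- The neighbors of `p` in a coordinate hyperplane through `p` are connected around `p` inside
that hyperplane. -/
theorem connIn_ring (hd : 3 ≤ d) {p r r' : Pt d} {k : Fin d} (hr : adj p r) (hr' : adj p r')
    (hrk : r k = p k) (hrk' : r' k = p k) :
    ConnIn {q | q k = p k ∧ ninf p q ≤ 1 ∧ q ≠ p} r r' := by
  have key : ∀ {r r' : Pt d} {m m' : Fin d}, m ≠ m' → r k = p k → r' k = p k →
      (p m - r m).natAbs = 1 → (∀ i, i ≠ m → p i = r i) →
      (p m' - r' m').natAbs = 1 → (∀ i, i ≠ m' → p i = r' i) →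
      ConnIn {q | q k = p k ∧ ninf p q ≤ 1 ∧ q ≠ p} r r' := by
    intro r r' m m' hmm hrk hrk' h1 h2 h3 h4
    have hle : ninf p r ≤ 1 := (adj_iff.2 ⟨m, h1, h2⟩ : adj p r).ninf_le
    have hle' : ninf p r' ≤ 1 := (adj_iff.2 ⟨m', h3, h4⟩ : adj p r').ninf_le
    have hmid : ∀ i, Function.update r m' (r' m') i = r i ∨
        Function.update r m' (r' m') i = r' i := by
      intro i
      by_cases hi : i = m'
      · subst hi; simp
      · simp [hi]
    have h5 : r m' = p m' := (h2 m' (Ne.symm hmm)).symm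
    have h6 : r' m = p m := (h4 m hmm).symm
    have hmm1 : Function.update r m' (r' m') m = r m := by simp [hmm]
    have hmm2 : Function.update r m' (r' m') m' = r' m' := by simp
    generalize Function.update r m' (r' m') = s at *
    have c1 : ConnIn {q | q k = p k ∧ ninf p q ≤ 1 ∧ q ≠ p} r s := by
      refine connIn_of_box_subset r s fun v hv => ⟨?_, ninf_le_iff.2 fun i => ?_, fun h => ?_⟩
      · have := hv k
        have := hmid k
        omega
      · have := hv i
        have := hmid i
        have := ninf_le_iff.1 hle i
        have := ninf_le_iff.1 hle' i
        omega
      · have := hv m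
        have := congrFun h m
        omega
    have c2 : ConnIn {q | q k = p k ∧ ninf p q ≤ 1 ∧ q ≠ p} s r' := by
      refine connIn_of_box_subset s r' fun v hv => ⟨?_, ninf_le_iff.2 fun i => ?_, fun h => ?_⟩
      · have := hv k
        have := hmid k
        omega
      · have := hv i
        have := hmid i
        have := ninf_le_iff.1 hle i
        have := ninf_le_iff.1 hle' i
        omega
      · have := hv m'
        have := congrFun h m'
        omega
    exact c1.trans c2
  obtain ⟨m, h1, h2⟩ := adj_iff.1 hr
  obtain ⟨m', h3, h4⟩ := adj_iff.1 hr'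
  by_cases hmm : m = m'
  · subst hmm
    obtain ⟨i, hi⟩ : ∃ i : Fin d, i ∉ ({k, m} : Finset (Fin d)) := by
      by_contra! hc
      have h := Finset.card_le_card (fun i _ => hc i : (Finset.univ : Finset (Fin d)) ⊆ {k, m})
      have := Finset.card_le_two (a := k) (b := m)
      simp only [Finset.card_univ, Fintype.card_fin] at h
      omega
    simp only [Finset.mem_insert, Finset.mem_singleton, not_or] at hi
    have h5 : (p + Pi.single i 1 : Pt d) k = p k := by simp [Ne.symm hi.1]
    have h6 : (p i - (p + Pi.single i 1 : Pt d) i).natAbs = 1 := by simp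
    have h7 : ∀ j, j ≠ i → p j = (p + Pi.single i 1 : Pt d) j := fun j hj => by simp [hj]
    exact (key (Ne.symm hi.2) hrk h5 h1 h2 h6 h7).trans (key hi.2 h5 hrk' h6 h7 h3 h4)
  · exact key hmm hrk hrk' h1 h2 h3 h4

/-- A half-infinite piece of a transient trajectory is an infinite connected set. -/
theorem IsTraj.notMem_fill {w : ℤ → Pt d} (hw : IsTraj w) {U : Set (Pt d)} {I : Set ℤ}
    (hI : I.Infinite) (hord : I.OrdConnected) (hU : ∀ l ∈ I, w l ∉ U) {l : ℤ} (hl : l ∈ I) :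
    w l ∉ fill U := by
  intro hfill
  have hsub : w '' I ⊆ Uᶜ := by
    rintro _ ⟨m, hm, rfl⟩
    exact hU m hm
  have hpath : ∀ (t : ℕ) (m : ℤ), m ∈ I → m + t ∈ I → ConnIn (w '' I) (w m) (w (m + t)) := by
    intro t
    induction t with
    | zero =>
      intro m hm _
      simpa using ConnIn.refl (Set.mem_image_of_mem w hm)
    | succ t ih =>
      intro m hm hmt
      have hmt' : m + t ∈ I := hord.out hm hmt ⟨by omega, by push_cast; omega⟩
      refine (ih m hm hmt').tail ?_ ⟨_, hmt, rfl⟩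
      have := hw.1 (m + t)
      rwa [show m + ↑(t + 1) = m + t + 1 by push_cast; ring]
  have hconn : ConnSet (w '' I) := by
    have hle : ∀ m ∈ I, ∀ m' ∈ I, m ≤ m' → ConnIn (w '' I) (w m) (w m') := by
      intro m hm m' hm' hmm
      obtain ⟨t, rfl⟩ := Int.le.dest hmm
      exact hpath t m hm hm'
    rintro _ ⟨m, hm, rfl⟩ _ ⟨m', hm', rfl⟩
    rcases le_total m m' with h | h
    · exact hle m hm m' hm' h
    · exact (hle m' hm' m hm h).symm
  have hfin := hfill _ (Set.mem_image_of_mem w hl) hsub hconn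
  obtain ⟨M, hM⟩ := (hfin.image fun z => n1 z 0).bddAbove
  have hev := hw.2.eventually (Filter.eventually_gt_atTop M)
  refine hI ((Filter.eventually_cofinite.1 hev).subset fun m hm => ?_)
  exact not_lt.2 (hM ⟨w m, ⟨m, hm, rfl⟩, rfl⟩)

/-- Around a cut-time the trajectory goes straight, and the neighbors of the cut-point off the
trajectory are connected around it. -/
theorem CutTime.connIn_ring (hd : 3 ≤ d) {w : ℤ → Pt d} (hw : IsTraj w) {c : ℤ}
    (hc : CutTime w c) {r r' : Pt d} (hr : adj (w c) r) (hr' : adj (w c) r')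
    (h1 : r ≠ w (c - 1)) (h2 : r ≠ w (c + 1)) (h1' : r' ≠ w (c - 1)) (h2' : r' ≠ w (c + 1)) :
    ConnIn {q | ninf (w c) q ≤ 1 ∧ ∀ l, q ≠ w l} r r' := by
  have ha : adj (w c) (w (c - 1)) := adj_comm.1 (by simpa using hw.1 (c - 1))
  obtain ⟨k, hk1, hk2⟩ := opposite_neighbors ha (hw.1 c) (hc (c - 1) (by omega) (c + 1) (by omega))
  refine (RI.connIn_ring hd hr hr' (((hk1 r hr).resolve_left h1).resolve_left h2)
    (((hk1 r' hr').resolve_left h1').resolve_left h2')).mono ?_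
  rintro q ⟨hqk, hqp, hne⟩
  refine ⟨hqp, fun l hl => ?_⟩
  obtain ⟨h3, h4⟩ := hk2 q hqk hqp
  rcases lt_trichotomy l c with hlc | rfl | hlc
  · exact absurd (hc l hlc (c + 1) (by omega)) (by rw [← hl]; omega)
  · exact hne hl
  · have : ninf (w (c - 1)) q ≤ 1 :=
      ninf_le_iff.2 fun i => by have := ninf_le_iff.1 h3 i; omega
    exact absurd (hc (c - 1) (by omega) l hlc) (by rw [← hl]; omega)

theorem CutTime.eq_of_apply_eq {w : ℤ → Pt d} (hw : IsTraj w) {c l : ℤ} (hc : CutTime w c)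
    (h : w l = w c) : l = c := by
  rcases lt_trichotomy l c with hlc | rfl | hlc
  · have := hc l hlc (c + 1) (by omega)
    rw [h] at this
    exact absurd this (not_lt.2 (hw.1 c).ninf_le)
  · rfl
  · have := hc (c - 1) (by omega) l hlc
    rw [h] at this
    have h' : adj (w (c - 1)) (w c) := by simpa using hw.1 (c - 1)
    exact absurd this (not_lt.2 h'.ninf_le)

/-- Every point has a neighbor other than two given points. -/
theorem exists_adj_ne (hd : 2 ≤ d) (p a b : Pt d) : ∃ r, adj p r ∧ r ≠ a ∧ r ≠ b := by
  by_contra! hc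
  have h : ∀ k (s : ℤ), s.natAbs = 1 → adj p (p + Pi.single k s) := fun k s hs =>
    adj_iff.2 ⟨k, by simpa using hs, fun i hi => by simp [hi]⟩
  let i : Fin d := ⟨0, by omega⟩
  let j : Fin d := ⟨1, by omega⟩
  have hij : i ≠ j := by simp [i, j]
  have key : ∀ u v : Pt d, u = p + Pi.single i 1 → v = p + Pi.single i (-1) →
      p + Pi.single j 1 ≠ u ∧ p + Pi.single j 1 ≠ v ∧ u ≠ v := by
    rintro u v rfl rfl
    refine ⟨fun h => ?_, fun h => ?_, fun h => ?_⟩ <;>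
      simpa [hij] using congrFun h i
  obtain ⟨k1, k2, k3⟩ := key _ _ rfl rfl
  have g1 := hc _ (h i 1 rfl)
  have g2 := hc _ (h i (-1) rfl)
  have g3 := hc _ (h j 1 rfl)
  grind

theorem le_diam {A : Set (Pt d)} {a b : Pt d} (ha : a ∈ A) (hb : b ∈ A) :
    (ninf a b : ℕ∞) ≤ diam A :=
  le_iSup₂_of_le a ha (le_iSup₂_of_le b hb le_rfl)

/-- if all sausages have diameter `< L₀/4`, then
`χ(fill({w(l) : n₀ < l < n_J})) = 0`. -/
theorem statement10 (d : ℕ) (hd : 3 ≤ d) (L₀ : ℕ) (hL0 : 8 ≤ L₀)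
    (w : ℤ → Pt d) (hw : IsTraj w) (J : ℕ) (n : ℕ → ℤ)
    (hgap : ∀ j < J, n j + 2 ≤ n (j + 1))
    (hcut : ∀ j ≤ J, CutTime w (n j))
    (hdiam : ∀ j < J, 4 * diam (sausage w n j) < (L₀ : ℕ∞)) :
    ¬ chi0 L₀ (fill (w '' {l | n 0 < l ∧ l < n J})) := by
  have hmono : ∀ i j, i ≤ j → j ≤ J → n i ≤ n j := by
    intro i j hij
    induction j, hij using Nat.le_induction with
    | base => exact fun _ => le_rfl
    | succ j _ ih => intro hj; have := ih (by omega); have := hgap j (by omega); omega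
  set U := sausage w n
  set V := w '' {l | n 0 < l ∧ l < n J}
  let P : Set (Pt d) := {p | ∃ j, 0 < j ∧ j < J ∧ p = w (n j)}
  have hVfin : V.Finite := (Set.finite_Ioo (n 0) (n J)).image w
  have hV : ∀ z ∈ V, z ∈ {z | ∃ j < J, z ∈ U j} ∨ z ∈ P := by
    rintro _ ⟨l, ⟨hl0, hlJ⟩, rfl⟩
    have key : ∀ m ≤ J, l < n m → w l ∈ {z | ∃ j < J, z ∈ U j} ∨ w l ∈ P := by
      intro m
      induction m with
      | zero => intro _ h; omega
      | succ m ih =>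
        intro hm hlm
        rcases lt_trichotomy l (n m) with h | h | h
        · exact ih (by omega) h
        · refine Or.inr ⟨m, Nat.pos_of_ne_zero ?_, by omega, by rw [h]⟩
          rintro rfl
          omega
        · exact Or.inl ⟨m, by omega, l, ⟨h, hlm⟩, rfl⟩
    exact key J le_rfl hlJ
  have hUV : ∀ j < J, U j ⊆ V := by
    rintro j hj _ ⟨l, ⟨h1, h2⟩, rfl⟩
    have := hmono 0 j (by omega) (by omega)
    have := hmono (j + 1) J (by omega) le_rfl
    exact ⟨l, ⟨by omega, by omega⟩, rfl⟩
  have hPV : P ⊆ V := by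
    rintro _ ⟨j, h0, hj, rfl⟩
    have := hmono 1 j (by omega) (by omega)
    have : n 0 + 2 ≤ n 1 := hgap 0 (by omega)
    have := hmono (j + 1) J (by omega) le_rfl
    have := hgap j hj
    exact ⟨n j, ⟨by omega, by omega⟩, rfl⟩
  have hfar : ∀ i < J, ∀ j < J, i ≠ j → farInf (U i) (U j) := by
    rintro i hi j hj hij _ ⟨l, ⟨h1, h2⟩, rfl⟩ _ ⟨l', ⟨h1', h2'⟩, rfl⟩
    rcases lt_or_gt_of_ne hij with h | h
    · have := hmono (i + 1) j (by omega) (by omega)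
      exact hcut (i + 1) (by omega) l h2 l' (by omega)
    · have := hmono (j + 1) i (by omega) (by omega)
      have h3 := hcut (j + 1) (by omega) l' h2' l (by omega)
      by_contra hle
      refine absurd h3 (not_lt.2 (ninf_le_iff.2 fun k => ?_))
      have := ninf_le_iff.1 (not_lt.1 hle) k
      omega
  have hpred : ∀ j, 0 < j → j < J → w (n j - 1) ∈ {z | ∃ j < J, z ∈ U j} := by
    intro j h0 hj
    obtain ⟨i, rfl⟩ : ∃ i, j = i + 1 := ⟨j - 1, by omega⟩
    have := hgap i (by omega)
    exact ⟨i, by omega, n (i + 1) - 1, ⟨by omega, by omega⟩, rfl⟩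
  have hsucc : ∀ j, 0 < j → j < J → w (n j + 1) ∈ {z | ∃ j < J, z ∈ U j} := by
    intro j h0 hj
    have := hgap j hj
    exact ⟨j, hj, n j + 1, ⟨by omega, by omega⟩, rfl⟩
  have hring : ∀ p ∈ P, ∀ r r', adj p r → adj p r' → r ∉ {z | ∃ j < J, z ∈ U j} →
      r' ∉ {z | ∃ j < J, z ∈ U j} → ConnIn {q | ninf p q ≤ 1 ∧ q ∉ V} r r' := by
    rintro _ ⟨j, h0, hj, rfl⟩ r r' hr hr' hrU hrU'
    refine ((hcut j hj.le).connIn_ring hd hw hr hr' (fun h => hrU (h ▸ hpred j h0 hj))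
      (fun h => hrU (h ▸ hsucc j h0 hj)) (fun h => hrU' (h ▸ hpred j h0 hj))
      fun h => hrU' (h ▸ hsucc j h0 hj)).mono ?_
    rintro q ⟨hq, hqw⟩
    refine ⟨hq, ?_⟩
    rintro ⟨l, -, rfl⟩
    exact hqw l rfl
  -- outside its own time window, the trajectory escapes to infinity avoiding `U j`
  have hescape : ∀ j < J, ∀ l, l ≤ n j ∨ n (j + 1) ≤ l → w l ∉ fill (U j) := by
    intro j hj l hl
    have havoid : ∀ m, m ≤ n j ∨ n (j + 1) ≤ m → w m ∉ U j := by
      rintro m hm ⟨l', ⟨h1, h2⟩, h3⟩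
      have hself : ninf (w l') (w m) ≤ 1 := by simp [h3, ninf]
      have hself' : ninf (w m) (w l') ≤ 1 := by simp [h3, ninf]
      rcases hm with hm | hm
      · rcases hm.lt_or_eq with hm | rfl
        · exact absurd (hcut j hj.le m hm l' h1) (not_lt.2 hself')
        · have := (hcut j hj.le).eq_of_apply_eq hw h3
          omega
      · rcases hm.lt_or_eq with hm | rfl
        · exact absurd (hcut (j + 1) hj l' h2 m hm) (not_lt.2 hself)
        · have := (hcut (j + 1) hj).eq_of_apply_eq hw h3
          omega
    rcases hl with hl | hl
    · exact hw.notMem_fill (I := Set.Iic (n j)) (Set.Iic_infinite _) Set.ordConnected_Iic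
        (fun m hm => havoid m (Or.inl hm)) hl
    · exact hw.notMem_fill (I := Set.Ici (n (j + 1))) (Set.Ici_infinite _) Set.ordConnected_Ici
        (fun m hm => havoid m (Or.inr hm)) hl
  have hUfill : ∀ i < J, ∀ j < J, i ≠ j → ∀ u ∈ U i, u ∉ fill (U j) := by
    rintro i hi j hj hij _ ⟨l, ⟨h1, h2⟩, rfl⟩
    refine hescape j hj _ ?_
    rcases lt_or_gt_of_ne hij with h | h
    · have := hmono (i + 1) j h hj.le
      omega
    · have := hmono (j + 1) i h hi.le
      omega
  have hPnbr : ∀ p ∈ P, ∃ r, adj p r ∧ r ∉ {z | ∃ j < J, z ∈ U j} := by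
    rintro _ ⟨j, h0, hj, rfl⟩
    obtain ⟨r, hr, hra, hrb⟩ := exists_adj_ne (by omega) (w (n j)) (w (n j - 1)) (w (n j + 1))
    refine ⟨r, hr, fun ⟨i, hi, hri⟩ => ?_⟩
    exact ((hcut j hj.le).connIn_ring hd hw hr hr hra hrb hra hrb).left_mem.2 _
      (hri.choose_spec.2).symm
  have hdiamU : ∀ j < J, ∀ u ∈ U j, ∀ v ∈ U j, ninf u v ≤ (L₀ - 1) / 4 := by
    intro j hj u hu v hv
    have h := (mul_le_mul_right (le_diam hu hv) 4).trans_lt (hdiam j hj)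
    have h' : 4 * ninf u v < L₀ := by exact_mod_cast h
    omega
  have hbd : ∀ A : Set (Pt d), A ⊆ boxCen L₀ 2 → ConnSet A → (L₀ : ℕ∞) ≤ 2 * diam A →
      ∃ x ∈ bd A, x ∉ fill V := by
    intro A hA hAc hAd
    refine exists_bd_notMem_fill (by omega) hVfin hV hUV hPV hfar hring hPnbr hUfill hdiamU
      ?_ hAc ?_
    · refine (Set.finite_Icc (fun _ => -(L₀ : ℤ)) (fun _ => 2 * (L₀ : ℤ))).subset fun z hz => ?_
      have hz' := hA hz
      simp only [boxCen, Set.mem_ofPred_eq] at hz'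
      refine ⟨fun i => ?_, fun i => ?_⟩ <;> have := hz' i <;> push_cast at this <;> simp only <;> omega
    · by_contra! hc
      have hle : diam A ≤ ((L₀ - 1) / 4 : ℕ) :=
        iSup₂_le fun a ha => iSup₂_le fun b hb => by exact_mod_cast hc a ha b hb
      have h := hAd.trans (mul_le_mul_right hle 2)
      have h' : L₀ ≤ 2 * ((L₀ - 1) / 4) := by exact_mod_cast h
      omega
  rintro ⟨A₁, A₂, hA₁, hA₂, hc₁, hc₂, hd₁, hd₂, -, hsep⟩
  obtain ⟨x, hxA, hx⟩ := hbd A₁ hA₁ hc₁ hd₁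
  obtain ⟨y, hyA, hy⟩ := hbd A₂ hA₂ hc₂ hd₂
  let T : Set (Pt d) := {z | ∀ k, -(L₀ : ℤ) - 1 ≤ z k ∧ z k ≤ 2 * L₀}
  let C : Set (Pt d) := {z | ∀ k, -(2 * (L₀ : ℤ)) + 1 ≤ z k ∧ z k ≤ 3 * L₀ - 2}
  have hbdT : ∀ A : Set (Pt d), A ⊆ boxCen L₀ 2 → bd A ⊆ T := by
    rintro A hA z ⟨-, a, ha, hza⟩ k
    have h1 := ninf_le_iff.1 hza.ninf_le k
    have h2 := hA ha k
    push_cast at h2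
    omega
  have hxT := hbdT A₁ hA₁ hxA
  have hyT := hbdT A₂ hA₂ hyA
  have hxV : x ∉ V := fun h => hx (subset_fill V h)
  have hconn : ConnIn {z | z ∈ C ∧ ∀ j < J, z ∉ U j} x y := by
    refine connIn_diff_iUnion (T := T) hfar (fun z hz k => ?_) ?_ (fun j hj h => hxV (hUV j hj h))
      (connIn_of_box_subset x y fun z hz k => ?_)
      fun j hj => (connIn_compl_of_notMem_fill (by omega) hVfin hx hy).mono
        (Set.compl_subset_compl.2 (hUV j hj))
    · have := hz k
      omega
    · rintro j hj ⟨z, hzT, hzU⟩ u hu v huv k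
      have h1 := ninf_le_iff.1 (hdiamU j hj z hzU u hu) k
      have h2 := ninf_le_iff.1 huv k
      have h3 := hzT k
      omega
    · have h1 := hxT k
      have h2 := hyT k
      have h3 := hz k
      omega
  have hyP : y ∉ P := fun h => hy (subset_fill V (hPV h))
  obtain ⟨τ, N, hτ, hτ0, hτN, hτC⟩ := (connIn_reroute (C := boxCen L₀ 3) (C' := C) hV
    (fun p hp r hpr k => by
      have h1 := hp k
      have h2 := ninf_le_iff.1 hpr k
      push_cast
      omega) hring hPV hxV
    (hconn.mono fun z hz => ⟨hz.1, fun ⟨j, hj, hzj⟩ => hz.2 j hj hzj⟩)).1 hyP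
  obtain ⟨l, hl, hlF⟩ := hsep τ N hτ (fun l hl => (hτC l hl).1) (hτ0 ▸ hxA) (hτN ▸ hyA)
  exact notMem_fill_of_connIn hx
    ⟨τ, l, fun k hk => hτ k (by omega), hτ0, rfl, fun k hk => (hτC k (by omega)).2⟩ hlF

end RI
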